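/- arXiv:1709.09877 — 4 statements merged into one kernel-verified Lean document; each statement's English description precedes it below -/
import Mathlib

section
/- Let $r_1, r_2, r_3, r_4 > 0$ be positive real numbers. There exist four affinely independent points $p_1, p_2, p_3, p_4$ in Euclidean $3$-space with pairwise distances $\mathrm{dist}(p_i, p_j) = r_i + r_j$ for all $i \neq j$ (i.e., a non-degenerate Euclidean tetrahedron with these edge lengths exists) if and only if $Q = \left(\frac{1}{r_1} + \frac{1}{r_2} + \frac{1}{r_3} + \frac{1}{r_4}\right)^2 - 2\left(\frac{1}{r_1^2} + \frac{1}{r_2^2} + \frac{1}{r_3^2} + \frac{1}{r_4^2}\right) > 0$. -/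
/-- The matrix whose rows are the edge vectors of a tetrahedron at its vertex `0`. -/
def edgeMatrix (p : Fin 4 → EuclideanSpace ℝ (Fin 3)) : Matrix (Fin 3) (Fin 3) ℝ :=
  Matrix.of fun i j => p i.succ j - p 0 j

theorem affineIndependent_iff_det_edgeMatrix_ne_zero (p : Fin 4 → EuclideanSpace ℝ (Fin 3)) :
    AffineIndependent ℝ p ↔ (edgeMatrix p).det ≠ 0 := by
  rw [affineIndependent_iff_linearIndependent_vsub ℝ p 0,
    ← linearIndependent_equiv (finSuccAboveEquiv (0 : Fin 4)),
    ← isUnit_iff_ne_zero, ← Matrix.isUnit_iff_isUnit_det,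
    ← Matrix.linearIndependent_rows_iff_isUnit,
    ← LinearMap.linearIndependent_iff (WithLp.linearEquiv 2 ℝ (Fin 3 → ℝ)).toLinearMap
      (LinearEquiv.ker _)]
  rfl

/-- The Gram determinant of a tetrahedron spanned by four pairwise tangent spheres. -/
theorem det_edgeMatrix_sq (r : Fin 4 → ℝ) (hr : ∀ i, 0 < r i)
    (p : Fin 4 → EuclideanSpace ℝ (Fin 3)) (hp : ∀ i j, i ≠ j → dist (p i) (p j) = r i + r j) :
    (edgeMatrix p).det ^ 2 = 4 * (r 0 * r 1 * r 2 * r 3) ^ 2 *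
      ((1 / r 0 + 1 / r 1 + 1 / r 2 + 1 / r 3) ^ 2
        - 2 * (1 / (r 0) ^ 2 + 1 / (r 1) ^ 2 + 1 / (r 2) ^ 2 + 1 / (r 3) ^ 2)) := by
  have hsq : ∀ i j, i ≠ j → (p i 0 - p j 0) ^ 2 + (p i 1 - p j 1) ^ 2 + (p i 2 - p j 2) ^ 2
      = (r i + r j) ^ 2 := by
    intro i j hij
    rw [← hp i j hij, EuclideanSpace.dist_eq, Real.sq_sqrt (by positivity), Fin.sum_univ_three]
    simp only [Real.dist_eq, sq_abs]
  have h01 := hsq 1 0 (by decide)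
  have h02 := hsq 2 0 (by decide)
  have h03 := hsq 3 0 (by decide)
  have h12 := hsq 1 2 (by decide)
  have h13 := hsq 1 3 (by decide)
  have h23 := hsq 2 3 (by decide)
  have hG : edgeMatrix p * (edgeMatrix p).transpose =
      !![(r 0 + r 1) ^ 2, r 0 ^ 2 + r 0 * r 1 + r 0 * r 2 - r 1 * r 2,
          r 0 ^ 2 + r 0 * r 1 + r 0 * r 3 - r 1 * r 3;
        r 0 ^ 2 + r 0 * r 1 + r 0 * r 2 - r 1 * r 2, (r 0 + r 2) ^ 2,
          r 0 ^ 2 + r 0 * r 2 + r 0 * r 3 - r 2 * r 3;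
        r 0 ^ 2 + r 0 * r 1 + r 0 * r 3 - r 1 * r 3,
          r 0 ^ 2 + r 0 * r 2 + r 0 * r 3 - r 2 * r 3, (r 0 + r 3) ^ 2] := by
    ext i j
    fin_cases i <;> fin_cases j <;>
      simp [edgeMatrix, Matrix.mul_apply, Fin.sum_univ_three] <;> linarith
  have h0 := (hr 0).ne'
  have h1 := (hr 1).ne'
  have h2 := (hr 2).ne'
  have h3 := (hr 3).ne'
  have hdet := congrArg Matrix.det hG
  rw [Matrix.det_mul, Matrix.det_transpose, ← sq] at hdet
  rw [hdet, Matrix.det_fin_three]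
  simp
  field_simp
  ring

/-- A positive Gram determinant lets one place the four centres by successive
orthogonalization of the edges at vertex `0`. -/
theorem exists_dist_eq_add (r : Fin 4 → ℝ) (hr : ∀ i, 0 < r i)
    (hQ : 0 < (1 / r 0 + 1 / r 1 + 1 / r 2 + 1 / r 3) ^ 2
        - 2 * (1 / (r 0) ^ 2 + 1 / (r 1) ^ 2 + 1 / (r 2) ^ 2 + 1 / (r 3) ^ 2)) :
    ∃ p : Fin 4 → EuclideanSpace ℝ (Fin 3), ∀ i j, i ≠ j → dist (p i) (p j) = r i + r j := by
  obtain ⟨a, ha⟩ : ∃ a, r 0 = a := ⟨_, rfl⟩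
  obtain ⟨b, hb⟩ : ∃ b, r 1 = b := ⟨_, rfl⟩
  obtain ⟨c, hc⟩ : ∃ c, r 2 = c := ⟨_, rfl⟩
  obtain ⟨d, hd⟩ : ∃ d, r 3 = d := ⟨_, rfl⟩
  have ha0 : 0 < a := ha ▸ hr 0
  have hb0 : 0 < b := hb ▸ hr 1
  have hc0 : 0 < c := hc ▸ hr 2
  have hd0 : 0 < d := hd ▸ hr 3
  rw [ha, hb, hc, hd] at hQ
  set Q := (1 / a + 1 / b + 1 / c + 1 / d) ^ 2
    - 2 * (1 / a ^ 2 + 1 / b ^ 2 + 1 / c ^ 2 + 1 / d ^ 2) with hQdef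
  let u := a ^ 2 + a * b + a * c - b * c
  let v := a ^ 2 + a * b + a * d - b * d
  let w := a ^ 2 + a * c + a * d - c * d
  let x := a + b
  have hx : 0 < x := by positivity
  obtain ⟨y, hy, hy2⟩ : ∃ y : ℝ, 0 < y ∧ y ^ 2 = 4 * a * b * c * (a + b + c) / x ^ 2 :=
    ⟨√(4 * a * b * c * (a + b + c) / x ^ 2), by positivity, Real.sq_sqrt (by positivity)⟩
  obtain ⟨z, hz2⟩ : ∃ z : ℝ, z ^ 2 = 4 * (a * b * c * d) ^ 2 * Q / (x * y) ^ 2 :=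
    ⟨√(4 * (a * b * c * d) ^ 2 * Q / (x * y) ^ 2), Real.sq_sqrt (by positivity)⟩
  let s := v / x
  let t := (w - u * v / x ^ 2) / y
  have hcc : (u / x) ^ 2 + y ^ 2 = (a + c) ^ 2 := by
    rw [hy2]; simp only [u, x]; field_simp; ring
  have hbc : x * (u / x) = u := by field_simp
  have hbd : x * s = v := by simp only [s]; field_simp
  have hcd : (u / x) * s + y * t = w := by simp only [s, t]; field_simp; ring
  have hdd : s ^ 2 + t ^ 2 + z ^ 2 = (a + d) ^ 2 := by
    rw [hz2]
    simp only [s, t, div_pow, mul_pow]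
    rw [hy2, hQdef]
    simp only [u, v, w, x]
    field_simp
    ring
  let p : Fin 4 → EuclideanSpace ℝ (Fin 3) :=
    ![!₂[0, 0, 0], !₂[x, 0, 0], !₂[u / x, y, 0], !₂[s, t, z]]
  have key : ∀ i j, i < j → dist (p i) (p j) = r i + r j := by
    intro i j hij
    rw [EuclideanSpace.dist_eq, Real.sqrt_eq_iff_eq_sq (by positivity)
      (add_pos (hr i) (hr j)).le, Fin.sum_univ_three]
    simp only [Real.dist_eq, sq_abs]
    fin_cases i <;> fin_cases j <;> first
      | exact absurd hij (by decide)
      | (simp [p, ha, hb, hc, hd]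
         simp only [u, v, w, x] at *
         try linarith)
  refine ⟨p, fun i j hij => ?_⟩
  rcases lt_or_gt_of_ne hij with h | h
  · exact key i j h
  · rw [dist_comm, add_comm]
    exact key j i h

/-- Cooper–Rivin non-degeneracy criterion: four positive radii `r 0, r 1, r 2, r 3`
are realized by a non-degenerate Euclidean tetrahedron with edge lengths
`l i j = r i + r j` if and only if
`(∑ 1/rᵢ)² - 2 ∑ 1/rᵢ² > 0`. -/
theorem cooper_rivin_nondegeneracy (r : Fin 4 → ℝ) (hr : ∀ i, 0 < r i) :
    (∃ p : Fin 4 → EuclideanSpace ℝ (Fin 3),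
      AffineIndependent ℝ p ∧ ∀ i j, i ≠ j → dist (p i) (p j) = r i + r j) ↔
    (1 / r 0 + 1 / r 1 + 1 / r 2 + 1 / r 3) ^ 2
      - 2 * (1 / (r 0) ^ 2 + 1 / (r 1) ^ 2 + 1 / (r 2) ^ 2 + 1 / (r 3) ^ 2) > 0 := by
  have hpos : 0 < 4 * (r 0 * r 1 * r 2 * r 3) ^ 2 := by
    have := hr 0
    have := hr 1
    have := hr 2
    have := hr 3
    positivity
  constructor
  · rintro ⟨p, hind, hp⟩
    have hdet := sq_pos_of_ne_zero ((affineIndependent_iff_det_edgeMatrix_ne_zero p).1 hind)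
    rw [det_edgeMatrix_sq r hr p hp] at hdet
    exact pos_of_mul_pos_right hdet hpos.le
  · intro hQ
    obtain ⟨p, hp⟩ := exists_dist_eq_add r hr hQ
    refine ⟨p, (affineIndependent_iff_det_edgeMatrix_ne_zero p).2 fun h => ?_, hp⟩
    have hdet := det_edgeMatrix_sq r hr p hp
    rw [h] at hdet
    exact (mul_pos hpos hQ).ne (by simpa using hdet)
end

section
/- Let $N \geq 1$, let $\alpha, \beta \in \mathbb{R}$ satisfy $\alpha - \beta + 2 = 0$. Let $I \subseteq \mathbb{R}$ be an interval, let $r : I \to \mathbb{R}^N$ be a differentiable curve with $r_i(t) > 0$ for all $i$ and $t$, and let $K : I \to \mathbb{R}^N$ be any function. Define $s_\alpha(t) = \frac{\sum_{i=1}^N K_i(t) r_i(t)}{\sum_{i=1}^N r_i(t)^{\alpha+1}}$. Suppose $r$ satisfies $\frac{dr_i}{dt} = s_\alpha(t)\, r_i(t)^{\beta} - K_i(t)\, r_i(t)^{\beta - \alpha}$ for all $i$ and $t$. Then the product $\prod_{i=1}^N r_i(t)$ is constant in $t$. -/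
open Finset

/-- If every factor satisfies `f i' = f i * g i` at `t`, then the product has logarithmic
derivative `∑ i, g i` at `t`. -/
theorem HasDerivAt.finset_prod_of_eq_mul {ι : Type*} [DecidableEq ι] {S : Finset ι}
    {f : ℝ → ι → ℝ} {g : ι → ℝ} {t : ℝ}
    (h : ∀ i ∈ S, HasDerivAt (fun u => f u i) (f t i * g i) t) :
    HasDerivAt (fun u => ∏ i ∈ S, f u i) ((∏ i ∈ S, f t i) * ∑ i ∈ S, g i) t := by
  refine (HasDerivAt.fun_finsetProd h).congr_deriv ?_
  rw [mul_sum]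
  refine sum_congr rfl fun i hi => ?_
  rw [smul_eq_mul, ← mul_assoc, prod_erase_mul S (f t) hi]

/-- Along the 3-dimensional unified `(α,β)`-flow, when `α - β + 2 = 0`,
the product `∏ i, r i` is invariant in time. -/
theorem prod_invariant_3d
    (N : ℕ) (hN : 1 ≤ N) (α β : ℝ) (hδ : α - β + 2 = 0)
    (I : Set ℝ) (hI : I.OrdConnected)
    (r K : ℝ → Fin N → ℝ)
    (hpos : ∀ t ∈ I, ∀ i, 0 < r t i)
    (s : ℝ → ℝ)
    (hs : ∀ t ∈ I, s t = (∑ i, K t i * r t i) / (∑ i, r t i ^ (α + 1)))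
    (hflow : ∀ t ∈ I, ∀ i,
      HasDerivAt (fun u => r u i) (s t * r t i ^ β - K t i * r t i ^ (β - α)) t) :
    ∀ t ∈ I, ∀ t' ∈ I, (∏ i, r t i) = ∏ i, r t' i := by
  have hderiv : ∀ t ∈ I, HasDerivAt (fun u => ∏ i, r u i) 0 t := by
    intro t ht
    have hβ : β = α + 1 + 1 := by linarith
    have hfactor : ∀ i ∈ univ, HasDerivAt (fun u => r u i)
        (r t i * (s t * r t i ^ (α + 1) - K t i * r t i)) t := by
      intro i _
      refine (hflow t ht i).congr_deriv ?_
      rw [show β - α = (2 : ℕ) by push_cast; linarith, Real.rpow_natCast, hβ,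
        Real.rpow_add_one (hpos t ht i).ne' (α + 1)]
      ring
    have : Nonempty (Fin N) := ⟨⟨0, hN⟩⟩
    have hsum : 0 < ∑ i, r t i ^ (α + 1) :=
      sum_pos (fun i _ => Real.rpow_pos_of_pos (hpos t ht i) _) univ_nonempty
    refine (HasDerivAt.finset_prod_of_eq_mul hfactor).congr_deriv ?_
    rw [sum_sub_distrib, ← mul_sum, hs t ht, div_mul_cancel₀ _ hsum.ne', sub_self, mul_zero]
  intro t ht t' ht'
  have hbound := hI.convex.norm_image_sub_le_of_norm_hasDerivWithin_le (C := 0)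
    (fun u hu => (hderiv u hu).hasDerivWithinAt) (fun _ _ => norm_zero.le) ht' ht
  rw [zero_mul, norm_le_zero_iff, sub_eq_zero] at hbound
  exact hbound
end

section
/- Let $N \geq 1$ and let $\Omega = \{r \in \mathbb{R}^N : r_i > 0 \text{ for all } i\}$. Let $K : \Omega \to \mathbb{R}^N$ be a continuous map, let $\alpha, \beta \in \mathbb{R}$, and define $s_\alpha(r) = \frac{\sum_{i=1}^N K_i(r)\, r_i}{\sum_{i=1}^N r_i^{\alpha+1}}$. Suppose $r : [0,\infty) \to \Omega$ is a differentiable solution of the unified $(\alpha,\beta)$-flow $\frac{dr_i}{dt} = s_\alpha(r(t))\, r_i(t)^{\beta} - K_i(r(t))\, r_i(t)^{\beta-\alpha}$, and suppose $r(t)$ converges as $t \to \infty$ to a point $r^* \in \Omega$. Then $K_i(r^*) = s_\alpha(r^*)\, (r^*_i)^{\alpha}$ for every $i$; in particular, the $\alpha$-curvature $K_i(r^*)/(r^*_i)^{\alpha}$ takes the same constant value $s_\alpha(r^*)$ at every index $i$. -/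
open Filter Finset

/-- If a function converges at `+∞` and its derivative converges as well, then the derivative
tends to zero. -/
lemma limit_deriv_eq_zero_of_tendsto_atTop {f f' : ℝ → ℝ} {a b t₀ : ℝ}
    (hderiv : ∀ t, t₀ ≤ t → HasDerivAt f (f' t) t)
    (hf : Tendsto f atTop (nhds a)) (hf' : Tendsto f' atTop (nhds b)) : b = 0 := by
  have hmvt : ∀ t, ∃ c, t ≤ c ∧ (t₀ ≤ t → f' c = f (t + 1) - f t) := by
    intro t
    by_cases ht : t₀ ≤ t
    · obtain ⟨c, hc, hfc⟩ := exists_hasDerivAt_eq_slope f f' (lt_add_one t)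
        (fun x hx => (hderiv x (ht.trans hx.1)).continuousAt.continuousWithinAt)
        (fun x hx => hderiv x (ht.trans hx.1.le))
      exact ⟨c, hc.1.le, fun _ => by simpa using hfc⟩
    · exact ⟨t, le_rfl, fun h => absurd h ht⟩
  choose c hc hfc using hmvt
  have hdiff : Tendsto (fun t => f (t + 1) - f t) atTop (nhds 0) := by
    simpa using (hf.comp (tendsto_atTop_add_const_right atTop 1 tendsto_id)).sub hf
  have hcomp : Tendsto (fun t => f' (c t)) atTop (nhds b) :=
    hf'.comp (tendsto_atTop_mono hc tendsto_id)
  refine tendsto_nhds_unique (hcomp.congr' ?_) hdiff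
  filter_upwards [eventually_ge_atTop t₀] with t ht using hfc t ht

/-- If the solution of the unified `(α,β)`-flow converges, the limit metric has
constant `α`-curvature: `K i (r*) = s_α(r*) · (r*_i)^α` for all `i`. -/
theorem unified_flow_limit_has_constant_alpha_curvature
    (N : ℕ) (hN : 1 ≤ N) (α β : ℝ)
    (K : (Fin N → ℝ) → (Fin N → ℝ))
    (hK : ContinuousOn K {r : Fin N → ℝ | ∀ i, 0 < r i})
    (s : (Fin N → ℝ) → ℝ)
    (hs : ∀ r : Fin N → ℝ,
      s r = (∑ i, K r i * r i) / (∑ i, r i ^ (α + 1)))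
    (r : ℝ → Fin N → ℝ)
    (hr : ∀ t : ℝ, 0 ≤ t → ∀ i, 0 < r t i)
    (hflow : ∀ t : ℝ, 0 ≤ t → ∀ i,
      HasDerivAt (fun u => r u i)
        (s (r t) * r t i ^ β - K (r t) i * r t i ^ (β - α)) t)
    (rstar : Fin N → ℝ) (hrstar : ∀ i, 0 < rstar i)
    (hlim : Tendsto r atTop (nhds rstar)) :
    ∀ i, K rstar i = s rstar * rstar i ^ α := by
  intro i
  have hcoord : ∀ j, Tendsto (fun t => r t j) atTop (nhds (rstar j)) :=
    tendsto_pi_nhds.mp hlim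
  have hrK : Tendsto (fun t => K (r t)) atTop (nhds (K rstar)) := by
    refine (hK rstar hrstar).tendsto.comp (tendsto_nhdsWithin_iff.mpr ⟨hlim, ?_⟩)
    filter_upwards [eventually_ge_atTop 0] with t ht using hr t ht
  have hrpow : ∀ (j : Fin N) (p : ℝ),
      Tendsto (fun t => r t j ^ p) atTop (nhds (rstar j ^ p)) :=
    fun j p => (hcoord j).rpow_const (Or.inl (hrstar j).ne')
  have hden : ∑ j, rstar j ^ (α + 1) ≠ 0 :=
    (sum_pos (fun j _ => Real.rpow_pos_of_pos (hrstar j) _) ⟨i, mem_univ i⟩).ne'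
  have hrs : Tendsto (fun t => s (r t)) atTop (nhds (s rstar)) := by
    simp only [hs]
    exact (tendsto_finsetSum _ fun j _ => (tendsto_pi_nhds.mp hrK j).mul (hcoord j)).div
      (tendsto_finsetSum _ fun j _ => hrpow j _) hden
  have hzero : s rstar * rstar i ^ β - K rstar i * rstar i ^ (β - α) = 0 :=
    limit_deriv_eq_zero_of_tendsto_atTop (fun t ht => hflow t ht i) (hcoord i)
      ((hrs.mul (hrpow i β)).sub ((tendsto_pi_nhds.mp hrK i).mul (hrpow i (β - α))))
  have hsplit : rstar i ^ β = rstar i ^ α * rstar i ^ (β - α) := by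
    rw [← Real.rpow_add (hrstar i), add_sub_cancel]
  apply mul_right_cancel₀ (Real.rpow_pos_of_pos (hrstar i) (β - α)).ne'
  rw [mul_assoc, ← hsplit]
  exact (sub_eq_zero.mp hzero).symm
end

section
/- Let $N \geq 2$, let $r \in \mathbb{R}^N$ have all entries positive, let $\Sigma = \mathrm{diag}(r_1, \ldots, r_N)$, and let $\alpha, \beta, s \in \mathbb{R}$. Let $\Lambda$ be a real symmetric positive semidefinite $N \times N$ matrix whose kernel is exactly the span of $r$, set $\widetilde{\Lambda} = \Sigma^{\frac{1-\alpha}{2}}\Lambda\Sigma^{\frac{1-\alpha}{2}}$, and assume the spectral gap condition: $\langle \widetilde{\Lambda} v, v\rangle > \alpha s\, \|v\|^2$ for every nonzero vector $v$ orthogonal to the componentwise power $r^{\frac{\alpha+1}{2}}$. Define $A = \Sigma^{\beta-\alpha}\left(-\Lambda + \alpha s\left(\Sigma^{\alpha-1} - \frac{r^{\alpha}(r^{\alpha})^T}{\|r\|_{\alpha+1}^{\alpha+1}}\right)\right)$, where $r^{\alpha} = (r_1^{\alpha}, \ldots, r_N^{\alpha})$, $\|r\|_{\alpha+1}^{\alpha+1}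 = \sum_i r_i^{\alpha+1}$, and $\Sigma^t = \mathrm{diag}(r_i^t)$. Then all eigenvalues of $A$ are real and nonpositive, the kernel of $A$ is exactly the one-dimensional span of $r$, and every nonzero eigenvalue of $A$ is strictly negative. -/
open Matrix Finset

/-- The complex eigenvalues of `-P B`, with `P` a positive diagonal matrix and `B` positive
semidefinite, are real and nonpositive. -/
theorem isRoot_charpoly_diagonal_mul_neg_posSemidef {n : Type*} [Fintype n] [DecidableEq n]
    {p : n → ℝ} (hp : ∀ i, 0 < p i) {B : Matrix n n ℝ} (hB : B.PosSemidef) {μ : ℂ}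
    (hμ : ((diagonal p * -B).charpoly.map (algebraMap ℝ ℂ)).IsRoot μ) :
    ∃ x : ℝ, x ≤ 0 ∧ μ = x := by
  set Q : Matrix n n ℝ := diagonal fun i => √(p i) with hQ
  have hQQ : diagonal p = Q * Q := by
    rw [hQ, diagonal_mul_diagonal]
    exact congrArg diagonal (funext fun i => (Real.mul_self_sqrt (hp i).le).symm)
  have hH : (Q * B * Q).PosSemidef := by
    have h := hB.mul_mul_conjTranspose_same Q
    rwa [hQ, diagonal_conjTranspose, star_trivial] at h
  have hchar : (diagonal p * -B).charpoly = (-(Q * B * Q)).charpoly := by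
    rw [hQQ, mul_assoc, charpoly_mul_comm]
    simp [mul_assoc]
  have hneg : (-(Q * B * Q)).IsHermitian := hH.1.neg
  rw [hchar, hneg.charpoly_eq, Polynomial.map_prod, Polynomial.isRoot_prod] at hμ
  obtain ⟨i, -, hi⟩ := hμ
  refine ⟨hneg.eigenvalues i, ?_, ?_⟩
  · have h := hH.dotProduct_mulVec_nonneg (hneg.eigenvectorBasis i)
    rw [hneg.eigenvalues_eq, neg_mulVec, dotProduct_neg]
    simpa using h
  · simpa [sub_eq_zero] using hi

/-- A symmetric matrix that annihilates `r` and is positive definite on a hyperplane `w^⊥` not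
containing `r` is positive semidefinite with kernel spanned by `r`. -/
theorem posSemidef_and_ker_of_pos_on_hyperplane {n : Type*} [Fintype n] {B : Matrix n n ℝ}
    (hB : B.IsSymm) {r w : n → ℝ} (hr : B *ᵥ r = 0) (hwr : w ⬝ᵥ r ≠ 0)
    (hpos : ∀ u : n → ℝ, u ≠ 0 → w ⬝ᵥ u = 0 → 0 < u ⬝ᵥ B *ᵥ u) :
    B.PosSemidef ∧ ∀ v : n → ℝ, B *ᵥ v = 0 ↔ ∃ c : ℝ, v = c • r := by
  have hproj (v : n → ℝ) : ∃ (c : ℝ) (u : n → ℝ), w ⬝ᵥ u = 0 ∧ v = c • r + u := by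
    refine ⟨w ⬝ᵥ v / w ⬝ᵥ r, v - (w ⬝ᵥ v / w ⬝ᵥ r) • r, ?_, by abel⟩
    rw [dotProduct_sub, dotProduct_smul, smul_eq_mul, div_mul_cancel₀ _ hwr, sub_self]
  have hrB (x : n → ℝ) : r ⬝ᵥ B *ᵥ x = 0 := by
    rw [dotProduct_mulVec, ← mulVec_transpose, hB.eq, hr, zero_dotProduct]
  have hmul (c : ℝ) (u : n → ℝ) : B *ᵥ (c • r + u) = B *ᵥ u := by
    rw [mulVec_add, mulVec_smul, hr, smul_zero, zero_add]
  refine ⟨.of_dotProduct_mulVec_nonneg ?_ fun v => ?_, fun v => ⟨fun hv => ?_, ?_⟩⟩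
  · rwa [IsHermitian, conjTranspose_eq_transpose_of_trivial]
  · obtain ⟨c, u, hu, rfl⟩ := hproj v
    rw [star_trivial, hmul, add_dotProduct, smul_dotProduct, hrB, smul_zero, zero_add]
    rcases eq_or_ne u 0 with rfl | h0
    · simp
    · exact (hpos u h0 hu).le
  · obtain ⟨c, u, hu, rfl⟩ := hproj v
    rw [hmul] at hv
    rcases eq_or_ne u 0 with rfl | h0
    · exact ⟨c, add_zero _⟩
    · have h := hpos u h0 hu
      rw [hv, dotProduct_zero] at h
      exact absurd h (lt_irrefl _)
  · rintro ⟨c, rfl⟩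
    rw [mulVec_smul, hr, smul_zero]

/-- Linear-algebraic core of the stability theorem for the unified `(α,β)`-flow:
under the spectral gap condition for `Λ̃ = Σ^{(1-α)/2} Λ Σ^{(1-α)/2}`, the
Jacobian-type matrix
`A = Σ^{β-α} (-Λ + αs (Σ^{α-1} - r^α (r^α)^T / ‖r‖_{α+1}^{α+1}))`
has only real nonpositive eigenvalues, its kernel is exactly `span{r}`, and
every nonzero eigenvalue is strictly negative. -/
theorem stability_jacobian_spectrum
    (N : ℕ) (hN : 2 ≤ N) (r : Fin N → ℝ) (hr : ∀ i, 0 < r i) (α β s : ℝ)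
    (Λ : Matrix (Fin N) (Fin N) ℝ)
    (hΛsymm : Λ.IsSymm) (hΛpsd : Λ.PosSemidef)
    (hker : ∀ v : Fin N → ℝ, Λ.mulVec v = 0 ↔ ∃ c : ℝ, v = c • r)
    (Λt : Matrix (Fin N) (Fin N) ℝ)
    (hΛt : Λt = diagonal (fun i => r i ^ ((1 - α) / 2)) * Λ *
      diagonal (fun i => r i ^ ((1 - α) / 2)))
    (hgap : ∀ v : Fin N → ℝ, v ≠ 0 →
      v ⬝ᵥ (fun i => r i ^ ((α + 1) / 2)) = 0 →
      α * s * (v ⬝ᵥ v) < Λt.mulVec v ⬝ᵥ v)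
    (A : Matrix (Fin N) (Fin N) ℝ)
    (hA : A = diagonal (fun i => r i ^ (β - α)) *
      (-Λ + (α * s) • (diagonal (fun i => r i ^ (α - 1)) -
        (∑ j, r j ^ (α + 1))⁻¹ •
          vecMulVec (fun i => r i ^ α) (fun i => r i ^ α)))) :
    (∀ μ : ℂ, (A.charpoly.map (algebraMap ℝ ℂ)).IsRoot μ →
      μ.im = 0 ∧ μ.re ≤ 0 ∧ (μ ≠ 0 → μ.re < 0)) ∧
    (∀ v : Fin N → ℝ, A.mulVec v = 0 ↔ ∃ c : ℝ, v = c • r) := by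
  set S : ℝ := ∑ j, r j ^ (α + 1) with hS
  set w : Fin N → ℝ := fun i => r i ^ α with hw
  set D : Matrix (Fin N) (Fin N) ℝ := diagonal fun i => r i ^ (α - 1) with hD
  set B : Matrix (Fin N) (Fin N) ℝ := Λ - (α * s) • (D - S⁻¹ • vecMulVec w w) with hB
  have hAB : A = diagonal (fun i => r i ^ (β - α)) * -B := by
    rw [hA, hB, neg_sub, neg_add_eq_sub]
  have hwr : w ⬝ᵥ r = S :=
    sum_congr rfl fun i _ => (Real.rpow_add_one (hr i).ne' α).symm
  have hS0 : S ≠ 0 :=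
    (sum_pos (fun i _ => Real.rpow_pos_of_pos (hr i) _) ⟨⟨0, by omega⟩, mem_univ _⟩).ne'
  have hBmul (u : Fin N → ℝ) :
      B *ᵥ u = Λ *ᵥ u - (α * s) • (D *ᵥ u - (S⁻¹ * w ⬝ᵥ u) • w) := by
    simp [hB, sub_mulVec, smul_mulVec, vecMulVec_mulVec, smul_smul]
  have hBr : B *ᵥ r = 0 := by
    have hDr : D *ᵥ r = w := by
      ext i
      rw [hD, mulVec_diagonal, hw, ← Real.rpow_add_one (hr i).ne', sub_add_cancel]
    rw [hBmul, hwr, inv_mul_cancel₀ hS0, hDr, (hker r).2 ⟨1, (one_smul _ _).symm⟩]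
    simp
  have hBsymm : B.IsSymm :=
    hΛsymm.sub (((isSymm_diagonal _).sub
      (IsSymm.smul (by rw [IsSymm, transpose_vecMulVec]) _)).smul _)
  have hBpos (u : Fin N → ℝ) (hu : u ≠ 0) (hwu : w ⬝ᵥ u = 0) : 0 < u ⬝ᵥ B *ᵥ u := by
    set y : Fin N → ℝ := fun i => r i ^ ((α - 1) / 2) * u i with hy
    have huy : diagonal (fun i => r i ^ ((1 - α) / 2)) *ᵥ y = u := by
      ext i
      rw [mulVec_diagonal, hy, ← mul_assoc, ← Real.rpow_add (hr i), ← add_div]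
      simp
    have hy0 : y ≠ 0 := by
      intro h
      rw [h, mulVec_zero] at huy
      exact hu huy.symm
    have hyw : y ⬝ᵥ (fun i => r i ^ ((α + 1) / 2)) = 0 := by
      rw [← hwu]
      refine sum_congr rfl fun i _ => ?_
      rw [hy, hw, mul_right_comm, ← Real.rpow_add (hr i)]
      ring_nf
    have hyy : y ⬝ᵥ y = u ⬝ᵥ D *ᵥ u := by
      refine sum_congr rfl fun i _ => ?_
      rw [hD, mulVec_diagonal, hy, mul_mul_mul_comm, ← Real.rpow_add (hr i)]
      ring_nf
    have hΛy : Λt *ᵥ y ⬝ᵥ y = u ⬝ᵥ Λ *ᵥ u := by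
      rw [hΛt, ← mulVec_mulVec, ← mulVec_mulVec, huy, dotProduct_comm, dotProduct_mulVec,
        ← mulVec_transpose, diagonal_transpose, huy]
    have h := hgap y hy0 hyw
    rw [hyy, hΛy] at h
    rw [hBmul, hwu, mul_zero, zero_smul, sub_zero, dotProduct_sub, dotProduct_smul, smul_eq_mul]
    exact sub_pos.2 h
  obtain ⟨hBpsd, hBker⟩ :=
    posSemidef_and_ker_of_pos_on_hyperplane hBsymm hBr (hwr ▸ hS0) hBpos
  have hp (i : Fin N) : 0 < r i ^ (β - α) := Real.rpow_pos_of_pos (hr i) _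
  refine ⟨fun μ hμ => ?_, fun v => ?_⟩
  · rw [hAB] at hμ
    obtain ⟨x, hx, rfl⟩ := isRoot_charpoly_diagonal_mul_neg_posSemidef hp hBpsd hμ
    exact ⟨Complex.ofReal_im x, hx, fun h => lt_of_le_of_ne hx fun h0 => h (by simpa using h0)⟩
  · rw [← hBker, hAB, ← mulVec_mulVec, neg_mulVec, funext_iff, funext_iff]
    refine forall_congr' fun i => ?_
    simp [mulVec_diagonal, (hp i).ne']
end
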